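/- arXiv:2001.00865 — 3 statements merged into one kernel-verified Lean document; each statement's English description precedes it below -/
import Mathlib

section
/- For an integer n ≥ 5, a rational prime p splits into exactly 4 primes in the cyclotomic field Q(ζ_{2^n}) if and only if p ≡ 7 (mod 16) or p ≡ 9 (mod 16). -/
open NumberField IntermediateField

/-- If `x ≡ 1 (mod 4)` then passing from `x` to `x ^ 2` raises the power of two dividing `x - 1`
by exactly one. -/
theorem two_pow_succ_dvd_sq_sub_one_iff {x : ℤ} (hx : x % 4 = 1) (j : ℕ) :
    2 ^ (j + 1) ∣ x ^ 2 - 1 ↔ 2 ^ j ∣ x - 1 := by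
  obtain ⟨m, hm⟩ : ∃ m, x = 4 * m + 1 := ⟨x / 4, by omega⟩
  have hfac : x ^ 2 - 1 = 2 * ((x - 1) * (2 * m + 1)) := by rw [hm]; ring
  have hcop : IsCoprime ((2 : ℤ) ^ j) (2 * m + 1) := IsCoprime.pow_left ⟨-m, 1, by ring⟩
  rw [hfac, pow_succ', mul_dvd_mul_iff_left two_ne_zero]
  exact ⟨hcop.dvd_of_dvd_mul_right, fun h ↦ h.mul_right _⟩

theorem two_pow_add_dvd_pow_two_pow_succ_sub_one_iff {x : ℤ} (hx : Odd x) (j k : ℕ) :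
    2 ^ (j + k) ∣ x ^ 2 ^ (k + 1) - 1 ↔ 2 ^ j ∣ x ^ 2 - 1 := by
  induction k with
  | zero => simp
  | succ k ih =>
    have hmod : x ^ 2 ^ (k + 1) % 4 = 1 := by
      rw [pow_succ, pow_mul]
      exact Int.sq_mod_four_eq_one_of_odd hx.pow
    rw [← ih, ← two_pow_succ_dvd_sq_sub_one_iff hmod, ← pow_mul, ← pow_succ, ← add_assoc]

theorem ZMod.orderOf_natCast_two_pow_eq_iff {n p : ℕ} (hn : 5 ≤ n) (hp : Odd p) :
    orderOf (p : ZMod (2 ^ n)) = 2 ^ (n - 3) ↔ p % 16 = 7 ∨ p % 16 = 9 := by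
  obtain ⟨k, rfl⟩ := Nat.exists_eq_add_of_le hn
  have hpow (e : ℕ) : (p : ZMod (2 ^ (5 + k))) ^ e = 1 ↔ (2 : ℤ) ^ (5 + k) ∣ (p : ℤ) ^ e - 1 := by
    rw [← sub_eq_zero]
    have := ZMod.intCast_zmod_eq_zero_iff_dvd ((p : ℤ) ^ e - 1) (2 ^ (5 + k))
    push_cast at this
    exact this
  have hodd : Odd (p : ℤ) := by exact_mod_cast hp
  have hupper := (hpow (2 ^ (k + 1 + 1))).trans (by
    simpa [add_assoc, add_comm, add_left_comm] using
      two_pow_add_dvd_pow_two_pow_succ_sub_one_iff hodd 4 (k + 1))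
  have hlower := (hpow (2 ^ (k + 1))).trans
    (two_pow_add_dvd_pow_two_pow_succ_sub_one_iff hodd 5 k)
  have hres : ((2 : ℤ) ^ 4 ∣ (p : ℤ) ^ 2 - 1 ∧ ¬ (2 : ℤ) ^ 5 ∣ (p : ℤ) ^ 2 - 1) ↔
      p % 16 = 7 ∨ p % 16 = 9 := by
    obtain ⟨q, r, hr, rfl⟩ : ∃ q r, r < 32 ∧ p = 32 * q + r :=
      ⟨p / 32, p % 32, Nat.mod_lt _ (by norm_num), (Nat.div_add_mod p 32).symm⟩
    have hsq : ((32 * q + r : ℕ) : ℤ) ^ 2 - 1 =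
        32 * (32 * q ^ 2 + 2 * q * r) + ((r : ℤ) ^ 2 - 1) := by push_cast; ring
    rw [hsq]
    generalize (32 * (q : ℤ) ^ 2 + 2 * q * r) = t
    interval_cases r <;> norm_num <;> omega
  rw [← hres, show 5 + k - 3 = k + 1 + 1 by omega]
  constructor
  · intro h
    refine ⟨hupper.mp (h ▸ pow_orderOf_eq_one _), fun hdvd ↦ ?_⟩
    have hle := Nat.le_of_dvd (by positivity) (orderOf_dvd_of_pow_eq_one (hlower.mpr hdvd))
    rw [h] at hle
    exact absurd hle (by simp [Nat.pow_lt_pow_right])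
  · rintro ⟨h4, h5⟩
    exact orderOf_eq_prime_pow (hlower.not.mpr h5) (hupper.mpr h4)

theorem setOf_isPrime_natCast_mem_eq_primesOver {K : Type*} [Field K] [NumberField K] {p : ℕ}
    (hp : p.Prime) :
    {P : Ideal (𝓞 K) | P.IsPrime ∧ (p : 𝓞 K) ∈ P} =
      (Ideal.span {(p : ℤ)}).primesOver (𝓞 K) := by
  ext P
  refine and_congr_right fun hP ↦ ?_
  rw [Ideal.liesOver_span_iff hP.ne_top (Nat.prime_iff_prime_int.mp hp)]
  simp

theorem IsCyclotomicExtension.Rat.ncard_primesOver_mul_orderOf {m : ℕ} [NeZero m] (K : Type*)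
    [Field K] [NumberField K] [IsCyclotomicExtension {m} ℚ K] {p : ℕ} [Fact p.Prime]
    (hm : ¬ p ∣ m) :
    ((Ideal.span {(p : ℤ)}).primesOver (𝓞 K)).ncard * orderOf (p : ZMod m) = m.totient := by
  have : IsGalois ℚ K := IsCyclotomicExtension.isGalois {m} ℚ K
  have h := Ideal.ncard_primesOver_mul_ramificationIdxIn_mul_inertiaDegIn
    (Ideal.span {(p : ℤ)}) (𝓞 K) Gal(K/ℚ)
  rwa [ramificationIdxIn_eq_of_not_dvd p K hm, inertiaDegIn_eq_of_not_dvd p K hm, one_mul,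
    IsGalois.card_aut_eq_finrank,
    IsCyclotomicExtension.finrank K (Polynomial.cyclotomic.irreducible_rat (NeZero.pos m))] at h

/-- For n ≥ 5, a rational prime p splits into exactly 4 primes in Q(ζ_{2^n})
iff p ≡ 7 or 9 (mod 16). -/
theorem stmt_0 (n : ℕ) (hn : 5 ≤ n) (K : Type*) [Field K] [NumberField K]
    (ζ : K) (hζ : IsPrimitiveRoot ζ (2 ^ n)) (hK : IntermediateField.adjoin ℚ {ζ} = ⊤)
    (p : ℕ) (hp : p.Prime) :
    {P : Ideal (𝓞 K) | P.IsPrime ∧ (p : 𝓞 K) ∈ P}.ncard = 4 ↔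
      (p % 16 = 7 ∨ p % 16 = 9) := by
  have : Fact p.Prime := ⟨hp⟩
  have hcyc : IsCyclotomicExtension {2 ^ n} ℚ K := by
    have := hζ.intermediateField_adjoin_isCyclotomicExtension ℚ
    rw [hK] at this
    exact IsCyclotomicExtension.equiv {2 ^ n} ℚ _ IntermediateField.topEquiv
  rw [setOf_isPrime_natCast_mem_eq_primesOver hp]
  obtain rfl | hodd := hp.eq_two_or_odd'
  · obtain ⟨k, rfl⟩ : ∃ k, n = k + 1 := ⟨n - 1, by omega⟩
    rw [IsCyclotomicExtension.Rat.ncard_primesOver_of_prime_pow 2 k K]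
    norm_num
  · have hdvd : ¬ p ∣ 2 ^ n := fun h ↦ by
      rw [(Nat.prime_dvd_prime_iff_eq hp Nat.prime_two).mp (hp.dvd_of_dvd_pow h)] at hodd
      exact absurd hodd (by decide)
    have hcard := IsCyclotomicExtension.Rat.ncard_primesOver_mul_orderOf K hdvd
    have htot : (2 ^ n).totient = 4 * 2 ^ (n - 3) := by
      rw [Nat.totient_prime_pow Nat.prime_two (by omega), show n - 1 = 2 + (n - 3) by omega,
        pow_add]
      norm_num
    rw [← ZMod.orderOf_natCast_two_pow_eq_iff hn hodd]
    rw [htot] at hcard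
    constructor <;> intro h <;> rw [h] at hcard
    · exact Nat.eq_of_mul_eq_mul_left (by norm_num) hcard
    · exact Nat.eq_of_mul_eq_mul_right (by positivity) hcard
end

section
/- Let n ≥ 3 and p ≡ 3 (mod 8) a prime, and let 𝔭 be a prime ideal of K_n = Q(ζ_{2^n}) above p. Then the quadratic norm residue symbol (ζ_{2^n}, p / 𝔭) for the extension K_n(√p)/K_n equals −1; equivalently, ζ_{2^n} is not a local norm at 𝔭 from K_n(√p). -/
open NumberField IntermediateField IsDedekindDomain

/-- `α` is a local norm at `v` from the quadratic extension `K(√d)/K`, i.e. the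
quadratic norm residue symbol `(α, d / v)` equals 1: `α` is represented by the
norm form `x² − d·y²` over the completion of `K` at `v`. -/
def IsLocalNorm (K : Type*) [Field K] [NumberField K] (d α : K)
    (v : HeightOneSpectrum (𝓞 K)) : Prop :=
  ∃ x y : v.adicCompletion K,
    algebraMap K (v.adicCompletion K) α =
      x ^ 2 - algebraMap K (v.adicCompletion K) d * y ^ 2

/-- For `p ≡ 3 (mod 8)`, the number `p ^ 2 ^ (m + 1) - 1` is exactly divisible by `2 ^ (m + 3)`. -/
lemma exists_odd_pow_two_pow_eq {p : ℕ} (hp3 : p % 8 = 3) (m : ℕ) :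
    ∃ t, Odd t ∧ p ^ 2 ^ (m + 1) = 2 ^ (m + 3) * t + 1 := by
  induction m with
  | zero =>
    obtain ⟨k, rfl⟩ : ∃ k, p = 8 * k + 3 := ⟨p / 8, by lia⟩
    exact ⟨8 * k ^ 2 + 6 * k + 1, ⟨4 * k ^ 2 + 3 * k, by ring⟩, by ring⟩
  | succ m ih =>
    obtain ⟨t, ht, h⟩ := ih
    refine ⟨t + 2 * (2 ^ (m + 1) * t ^ 2), ht.add_even (even_two_mul _), ?_⟩
    rw [pow_succ 2 (m + 1), pow_mul, h]
    ring

section Cyclotomic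

variable {N p k : ℕ} [NeZero N] {K : Type*} [Field K] [NumberField K]
  [IsCyclotomicExtension {N} ℚ K] {ζ : K}

/-- If `p ^ k ≡ 1 (mod N)`, the `k`-th power of Frobenius is trivial on the ring of integers of
the `N`-th cyclotomic field modulo `p`. -/
lemma IsPrimitiveRoot.natCast_dvd_pow_sub_self (hζ : IsPrimitiveRoot ζ N) (hp : p.Prime)
    (hpu : ¬ IsUnit (p : 𝓞 K)) (hk : p ^ k ≡ 1 [MOD N]) (a : 𝓞 K) :
    (p : 𝓞 K) ∣ a ^ p ^ k - a := by
  have := Fact.mk hp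
  let A := 𝓞 K ⧸ Ideal.span {(p : 𝓞 K)}
  have : CharP A p := CharP.quotient (𝓞 K) p hpu
  let f : 𝓞 K →+* A := Ideal.Quotient.mk _
  have hpow : hζ.toInteger ^ p ^ k = hζ.toInteger := by
    have hord : p ^ k ≡ 1 [MOD orderOf hζ.toInteger] :=
      hζ.toInteger_isPrimitiveRoot.eq_orderOf ▸ hk
    rw [← pow_mod_orderOf, hord, pow_mod_orderOf, pow_one]
  have heq : ((iterateFrobenius A p k).comp f).toIntAlgHom = f.toIntAlgHom := by
    refine hζ.integralPowerBasis.algHom_ext ?_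
    simp [iterateFrobenius_def, ← map_pow, hpow]
  have ha : f a ^ p ^ k = f a := DFunLike.congr_fun heq a
  rw [← Ideal.mem_span_singleton, ← Ideal.Quotient.eq_zero_iff_mem]
  change f _ = 0
  rw [map_sub, map_pow, ha, sub_self]

/-- A prime `p` with `p ^ k ≡ 1 (mod N)` is unramified in the `N`-th cyclotomic field. -/
lemma IsPrimitiveRoot.natCast_notMem_asIdeal_sq (hζ : IsPrimitiveRoot ζ N) (hp : p.Prime)
    (hk0 : k ≠ 0) (hk : p ^ k ≡ 1 [MOD N]) (v : HeightOneSpectrum (𝓞 K)) :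
    (p : 𝓞 K) ∉ v.asIdeal ^ 2 := by
  intro hmem
  have hpu : ¬ IsUnit (p : 𝓞 K) := fun hu ↦
    v.isPrime.ne_top (Ideal.eq_top_of_isUnit_mem _ (Ideal.pow_le_self two_ne_zero hmem) hu)
  obtain ⟨J, hJ⟩ := Ideal.dvd_span_singleton.2 hmem
  have hspan : Ideal.span {(p : 𝓞 K)} ≠ ⊥ := by
    simpa [Ideal.span_singleton_eq_bot] using hp.ne_zero
  have hle : v.asIdeal * J ≤ Ideal.span {(p : 𝓞 K)} := by
    intro x hx
    have hx2 : x ^ 2 ∈ Ideal.span {(p : 𝓞 K)} := by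
      have := Ideal.pow_mem_pow hx 2
      rw [mul_pow] at this
      rw [hJ]
      exact Ideal.mul_mono_right (Ideal.pow_le_self two_ne_zero) this
    have hxq : x ^ p ^ k ∈ Ideal.span {(p : 𝓞 K)} :=
      Ideal.mem_of_dvd _ (pow_dvd_pow x (hp.two_le.trans (Nat.le_self_pow hk0 p))) hx2
    have := hζ.natCast_dvd_pow_sub_self hp hpu hk x
    rw [← Ideal.mem_span_singleton] at this
    simpa using sub_mem hxq this
  rw [← Ideal.dvd_iff_le, hJ, pow_two, mul_assoc] at hle
  have h0 : v.asIdeal * J ≠ 0 := by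
    intro h
    rw [pow_two, mul_assoc, h, mul_zero] at hJ
    exact hspan hJ
  have := (mul_dvd_mul_iff_right h0).1 (by rwa [one_mul] : v.asIdeal * (v.asIdeal * J) ∣ 1 * _)
  exact v.prime.not_isUnit (isUnit_of_dvd_one this)

end Cyclotomic

section Local

variable {R K : Type*} [CommRing R] [IsDedekindDomain R] [Field K] [Algebra R K]
  [IsFractionRing R K] (v : HeightOneSpectrum R)

/-- `R` surjects onto the residue field of the completion at `v`. -/
lemma IsDedekindDomain.HeightOneSpectrum.exists_valued_sub_algebraMap_lt_one
    {x : v.adicCompletion K} (hx : Valued.v x ≤ 1) :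
    ∃ a : R, Valued.v (x - algebraMap K (v.adicCompletion K) (algebraMap R K a)) < 1 := by
  have hnhds : {z : v.adicCompletion K | Valued.v (z - x) < 1} ∈ nhds x := by
    rw [Valued.mem_nhds]
    exact ⟨1, fun z hz ↦ by simpa [Valuation.restrict_lt_one_iff] using hz⟩
  obtain ⟨b, hb⟩ := (HeightOneSpectrum.denseRange_algebraMap (K := K) v).exists_mem_open
    isOpen_interior ⟨x, mem_interior_iff_mem_nhds.2 hnhds⟩
  have hb : algebraMap K (v.adicCompletion K) b ∈ {z : v.adicCompletion K | Valued.v (z - x) < 1} :=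
    interior_subset hb
  rw [Set.mem_ofPred_eq] at hb
  have hbv : v.valuation K b ≤ 1 := by
    rw [← HeightOneSpectrum.valuedAdicCompletion_eq_valuation' (v := v) b]
    have := Valued.v.map_add (algebraMap K (v.adicCompletion K) b - x) x
    rw [sub_add_cancel] at this
    exact this.trans (max_le hb.le hx)
  obtain ⟨a, ha⟩ := v.exists_valuation_sub_lt_of_integer hbv 1
  refine ⟨a, ?_⟩
  rw [← HeightOneSpectrum.valuedAdicCompletion_eq_valuation'] at ha
  have ha : Valued.v (algebraMap K (v.adicCompletion K) (algebraMap R K a - b)) < 1 := ha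
  rw [map_sub] at ha
  rw [Valuation.map_sub_swap]
  convert Valued.v.map_add_lt ha hb using 2
  ring

/-- If `d` has valuation one at `v` and the `v`-unit `α` is of the form `x² - d y²` in the
completion, then `α` is a square modulo `v`. -/
lemma IsDedekindDomain.HeightOneSpectrum.exists_sub_sq_mem_of_eq_sq_sub_mul_sq
    {d α : R} (hd : d ∈ v.asIdeal) (hd2 : d ∉ v.asIdeal ^ 2) (hα : α ∉ v.asIdeal)
    {x y : v.adicCompletion K}
    (h : algebraMap K (v.adicCompletion K) (algebraMap R K α) =
      x ^ 2 - algebraMap K (v.adicCompletion K) (algebraMap R K d) * y ^ 2) :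
    ∃ a : R, α - a ^ 2 ∈ v.asIdeal := by
  have hval (r : R) : Valued.v (algebraMap K (v.adicCompletion K) (algebraMap R K r)) =
      v.intValuation r :=
    (HeightOneSpectrum.valuedAdicCompletion_eq_valuation' v _).trans (v.valuation_of_algebraMap r)
  have hdv : v.intValuation d = WithZero.exp (-1 : ℤ) := by
    have hd0 : d ≠ 0 := fun h ↦ hd2 (h ▸ zero_mem _)
    have h1 : v.intValuation d ≤ WithZero.exp (-((1 : ℕ) : ℤ)) := by
      rw [v.intValuation_le_pow_iff_mem, pow_one]
      exact hd
    have h2 : ¬ v.intValuation d ≤ WithZero.exp (-((2 : ℕ) : ℤ)) := by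
      rwa [v.intValuation_le_pow_iff_mem]
    rw [v.intValuation_eq_exp_neg_multiplicity hd0] at h1 h2 ⊢
    rw [WithZero.exp_le_exp] at h1 h2
    rw [WithZero.exp_inj]
    lia
  have hαv : v.intValuation α = 1 := (v.intValuation_eq_one_iff_mem_primeCompl α).2 hα
  have hx2 : x ^ 2 = algebraMap K (v.adicCompletion K) (algebraMap R K α) +
      algebraMap K (v.adicCompletion K) (algebraMap R K d) * y ^ 2 := by
    rw [h]; ring
  have hdy : Valued.v (algebraMap K (v.adicCompletion K) (algebraMap R K d) * y ^ 2) < 1 := by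
    by_contra! hge
    rcases eq_or_ne y 0 with rfl | hy
    · simp at hge
    obtain ⟨j, hj⟩ : ∃ j : ℤ, Valued.v y = WithZero.exp j :=
      ⟨_, (WithZero.exp_log ((Valuation.ne_zero_iff _).2 hy)).symm⟩
    have hvdy : Valued.v (algebraMap K (v.adicCompletion K) (algebraMap R K d) * y ^ 2) =
        WithZero.exp (-1 + 2 * j) := by
      rw [map_mul, hval, hdv, map_pow, hj, ← WithZero.exp_nsmul, ← WithZero.exp_add]
      simp
    rw [hvdy, ← WithZero.exp_zero, WithZero.exp_le_exp] at hge
    have hlt : Valued.v (algebraMap K (v.adicCompletion K) (algebraMap R K α)) <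
        Valued.v (algebraMap K (v.adicCompletion K) (algebraMap R K d) * y ^ 2) := by
      rw [hvdy, hval, hαv, ← WithZero.exp_zero, WithZero.exp_lt_exp]
      lia
    have hvx2 := Valued.v.map_add_eq_of_lt_right hlt
    rw [← hx2, hvdy, map_pow] at hvx2
    have hx0 : x ≠ 0 := by
      rintro rfl
      simp at hvx2
    rw [← WithZero.exp_log ((Valuation.ne_zero_iff Valued.v).2 hx0), ← WithZero.exp_nsmul,
      WithZero.exp_inj, nsmul_eq_mul] at hvx2
    push_cast at hvx2
    lia
  have hx : Valued.v x ≤ 1 := by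
    rw [← pow_le_one_iff two_ne_zero, ← map_pow, hx2]
    exact (Valued.v.map_add _ _).trans (max_le (by rw [hval, hαv]) hdy.le)
  obtain ⟨a, ha⟩ := v.exists_valued_sub_algebraMap_lt_one hx
  refine ⟨a, ?_⟩
  rw [← v.intValuation_lt_one_iff_mem, ← hval]
  set b := algebraMap K (v.adicCompletion K) (algebraMap R K a) with hb
  have hb1 : Valued.v b ≤ 1 := by rw [hb, hval]; exact v.intValuation_le_one a
  have hsq : Valued.v ((x - b) * (x + b)) < 1 := by
    rw [map_mul]
    exact mul_lt_one_of_lt_of_le ha ((Valued.v.map_add _ _).trans (max_le hx hb1))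
  convert Valued.v.map_sub_lt hsq hdy using 2
  rw [map_sub, map_sub, map_pow, map_pow, h]
  ring

end Local

/-- For n ≥ 3, p ≡ 3 (mod 8) prime and 𝔭 a prime of K_n = Q(ζ_{2^n}) above p, the
norm residue symbol (ζ_{2^n}, p / 𝔭) for K_n(√p)/K_n equals −1: ζ_{2^n} is not a
local norm at 𝔭. -/
theorem stmt_13 (n : ℕ) (hn : 3 ≤ n) (p : ℕ) (hp : p.Prime) (hp3 : p % 8 = 3)
    (K : Type*) [Field K] [NumberField K]
    (ζ : K) (hζ : IsPrimitiveRoot ζ (2 ^ n)) (hK : IntermediateField.adjoin ℚ {ζ} = ⊤)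
    (v : HeightOneSpectrum (𝓞 K)) (hv : (p : 𝓞 K) ∈ v.asIdeal) :
    ¬ IsLocalNorm K (p : K) ζ v := by
  obtain ⟨m, rfl⟩ : ∃ m, n = m + 3 := ⟨n - 3, by lia⟩
  have : IsCyclotomicExtension {2 ^ (m + 3)} ℚ K := by
    have h := hζ.intermediateField_adjoin_isCyclotomicExtension ℚ
    rw [hK] at h
    exact IsCyclotomicExtension.equiv _ ℚ _ IntermediateField.topEquiv
  obtain ⟨t, ht, hq⟩ := exists_odd_pow_two_pow_eq hp3 m
  have hmod : p ^ 2 ^ (m + 1) ≡ 1 [MOD 2 ^ (m + 3)] := by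
    rw [hq]
    simp [Nat.ModEq]
  have hpu : ¬ IsUnit (p : 𝓞 K) := fun hu ↦
    v.isPrime.ne_top (Ideal.eq_top_of_isUnit_mem _ hv hu)
  have hz : IsPrimitiveRoot hζ.toInteger (2 ^ (m + 3)) := hζ.toInteger_isPrimitiveRoot
  have hzv : hζ.toInteger ∉ v.asIdeal := fun h ↦
    v.isPrime.ne_top (Ideal.eq_top_of_isUnit_mem _ h (hz.isUnit (by positivity)))
  have hhalf : hζ.toInteger ^ 2 ^ (m + 2) = -1 :=
    (hz.pow (by positivity) (by ring : 2 ^ (m + 3) = 2 ^ (m + 2) * 2)).eq_neg_one_of_two_right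
  rintro ⟨x, y, hxy⟩
  obtain ⟨a, ha⟩ := v.exists_sub_sq_mem_of_eq_sq_sub_mul_sq (K := K) (x := x) (y := y) hv
    (hζ.natCast_notMem_asIdeal_sq hp (by positivity) hmod v) hzv (by
      rw [map_natCast (algebraMap (𝓞 K) K)]
      exact hxy)
  have hfrob : a ^ p ^ 2 ^ (m + 1) - a ∈ v.asIdeal :=
    Ideal.mem_of_dvd _ (hζ.natCast_dvd_pow_sub_self hp hpu hmod a) hv
  let f : 𝓞 K →+* 𝓞 K ⧸ v.asIdeal := Ideal.Quotient.mk _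
  have hf {b : 𝓞 K} : f b = 0 ↔ b ∈ v.asIdeal := Ideal.Quotient.eq_zero_iff_mem
  have hsq : f a ^ 2 = f hζ.toInteger := by
    rw [← hf, map_sub, map_pow, sub_eq_zero] at ha
    exact ha.symm
  have hneg : f a ^ p ^ 2 ^ (m + 1) = -f a := by
    rw [hq, pow_succ, show 2 ^ (m + 3) * t = 2 * (2 ^ (m + 2) * t) by ring, pow_mul, hsq, pow_mul,
      ← map_pow, hhalf, map_neg, map_one, ht.neg_one_pow, neg_one_mul]
  rw [← hf, map_sub, map_pow, hneg] at hfrob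
  have h2a : (2 : 𝓞 K) * a ∈ v.asIdeal := by
    rw [← hf, map_mul, map_ofNat]
    linear_combination -hfrob
  rcases v.isPrime.mem_or_mem h2a with h2 | h
  · have hpodd : p = 2 * (p / 2) + 1 := by lia
    rw [hpodd] at hv
    push_cast at hv
    exact v.isPrime.ne_top ((Ideal.eq_top_iff_one _).2
      ((Ideal.add_mem_iff_right _ (Ideal.mul_mem_right _ _ h2)).1 hv))
  · rw [← hf] at h
    rw [h, zero_pow two_ne_zero] at hsq
    exact hzv (hf.1 hsq.symm)
end

section
/- Let n ≥ 3 and p ≡ 9 (mod 16) a prime, and 𝔭 a prime ideal of K_n = Q(ζ_{2^n}) above p. Then the norm residue symbol (ζ_{2^n}, p / 𝔭) for K_n(√p)/K_n equals −1, and for the cyclotomic unit ξ_{k,n} with k ≡ ±3 (mod 8) one has (ξ_{k,n}, p / 𝔭) = −(2/p)_4, while (ξ_{k,n}, p / 𝔭) = 1 for k ≡ ±1 (mod 8). -/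
open NumberField IntermediateField IsDedekindDomain

lemma exists_pow_two_pow_eq {p : ℕ} (hp9 : p % 16 = 9) (m : ℕ) :
    ∃ c, p ^ 2 ^ m = 2 ^ (m + 3) * (2 * c + 1) + 1 := by
  induction m with
  | zero => exact ⟨p / 16, by norm_num; omega⟩
  | succ m ih =>
    obtain ⟨c, hc⟩ := ih
    refine ⟨c + 2 ^ (m + 1) * (2 * c + 1) ^ 2, ?_⟩
    rw [pow_succ 2 m, pow_mul, hc]
    ring

/-- The shape of the real cyclotomic unit `ξ_{k,n}` with `k = 2 * j + 1`. -/
noncomputable def cyclotomicQuotient {F : Type*} [Field F] (j : ℕ) (z : F) : F :=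
  z⁻¹ ^ j * ((1 - z ^ (2 * j + 1)) / (1 - z))

section CyclotomicQuotient

variable {F : Type*} [Field F]

lemma map_cyclotomicQuotient {F' : Type*} [Field F'] (f : F →+* F') (j : ℕ) (z : F) :
    f (cyclotomicQuotient j z) = cyclotomicQuotient j (f z) := by
  simp [cyclotomicQuotient]

lemma cyclotomicQuotient_mul_neg (j : ℕ) (z : F) :
    cyclotomicQuotient j z * cyclotomicQuotient j (-z) =
      (-1) ^ j * cyclotomicQuotient j (z ^ 2) := by
  simp only [cyclotomicQuotient]
  have h1 : (1 - z ^ (2 * j + 1)) * (1 - (-z) ^ (2 * j + 1)) = 1 - (z ^ 2) ^ (2 * j + 1) := by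
    rw [Odd.neg_pow (by simp)]; ring
  have h2 : (1 - z) * (1 - -z) = 1 - z ^ 2 := by ring
  rw [← h1, ← h2, mul_div_mul_comm, inv_neg, neg_pow z⁻¹]
  simp only [inv_pow]
  ring

lemma cyclotomicQuotient_eq_geom_sum (j : ℕ) {z : F} (hz : z ≠ 1) :
    cyclotomicQuotient j z = z⁻¹ ^ j * ∑ i ∈ Finset.range (2 * j + 1), z ^ i := by
  rw [cyclotomicQuotient, ← neg_div_neg_eq, neg_sub, neg_sub, geom_sum_eq hz]

lemma cyclotomicQuotient_add_four (j : ℕ) {z : F} (hz : z ^ 4 = -1) :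
    cyclotomicQuotient (j + 4) z = - cyclotomicQuotient j z := by
  have h8 : z ^ (2 * (j + 4) + 1) = z ^ (2 * j + 1) := by
    rw [show 2 * (j + 4) + 1 = 2 * j + 1 + 4 * 2 by ring, pow_add, pow_mul, hz]; simp
  have h4 : z⁻¹ ^ (j + 4) = - z⁻¹ ^ j := by rw [pow_add, inv_pow z 4, hz]; simp
  rw [cyclotomicQuotient, h8, h4, cyclotomicQuotient, neg_mul]

lemma cyclotomicQuotient_pow_of_modEq {a : ℕ} (ha : Even a) {j r : ℕ} (hj : j % 4 = r) {z : F}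
    (hz : z ^ 4 = -1) : cyclotomicQuotient j z ^ a = cyclotomicQuotient r z ^ a := by
  induction j using Nat.strong_induction_on with
  | _ j ih =>
    by_cases h : j < 4
    · rw [← hj, Nat.mod_eq_of_lt h]
    · obtain ⟨i, rfl⟩ := Nat.exists_eq_add_of_le' (not_lt.1 h)
      rw [cyclotomicQuotient_add_four i hz, ha.neg_pow, ih i (by omega) (by omega)]

lemma pow_half_eq_neg_one {p : ℕ} (hp9 : p % 16 = 9) (m : ℕ) {z : F} (hz : z ^ 2 ^ (m + 2) = -1) :
    z ^ (p ^ 2 ^ m / 2) = -1 := by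
  obtain ⟨c, hc⟩ := exists_pow_two_pow_eq hp9 m
  have : p ^ 2 ^ m / 2 = 2 ^ (m + 2) * (2 * c + 1) := by
    rw [hc, show 2 ^ (m + 3) * (2 * c + 1) + 1 = 1 + 2 * (2 ^ (m + 2) * (2 * c + 1)) by ring]
    omega
  rw [this, pow_mul, hz, Odd.neg_one_pow (by simp)]

lemma even_pow_half {p : ℕ} (hp9 : p % 16 = 9) (m : ℕ) : Even (p ^ 2 ^ m / 2) := by
  obtain ⟨c, hc⟩ := exists_pow_two_pow_eq hp9 m
  refine ⟨2 ^ (m + 1) * (2 * c + 1), ?_⟩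
  rw [hc, show 2 ^ (m + 3) * (2 * c + 1) + 1 = 1 + 2 * (2 * (2 ^ (m + 1) * (2 * c + 1))) by ring]
  omega

variable {p : ℕ} [hp : Fact p.Prime] [CharP F p]

lemma neg_one_ne_one_of_mod_sixteen (hp9 : p % 16 = 9) : (-1 : F) ≠ 1 :=
  Ring.neg_one_ne_one_of_char_ne_two (by rw [ringChar.eq F p]; rintro rfl; omega)

lemma cyclotomicQuotient_pow_half (hp9 : p % 16 = 9) (j m : ℕ) {z : F}
    (hz : z ^ 2 ^ (m + 2) = -1) :
    cyclotomicQuotient j z ^ (p ^ 2 ^ m / 2) = cyclotomicQuotient j (z ^ 2 ^ m) ^ (p / 2) := by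
  induction m generalizing z with
  | zero => simp
  | succ m ih =>
    obtain ⟨c, hc⟩ := exists_pow_two_pow_eq hp9 m
    have hfrob : z ^ p ^ 2 ^ m = -z := by
      rw [hc, pow_succ, pow_mul, hz, Odd.neg_one_pow (by simp), neg_one_mul]
    have hexp : p ^ 2 ^ (m + 1) / 2 = (1 + p ^ 2 ^ m) * (p ^ 2 ^ m / 2) := by
      have : p ^ 2 ^ m = 2 * (p ^ 2 ^ m / 2) + 1 := by
        rw [hc, show 2 ^ (m + 3) * (2 * c + 1) + 1 = 1 + 2 * (2 ^ (m + 2) * (2 * c + 1)) by ring]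
        omega
      rw [pow_succ 2 m, pow_mul]
      generalize p ^ 2 ^ m / 2 = e at *
      rw [this, show (2 * e + 1) ^ 2 = 1 + 2 * ((1 + (2 * e + 1)) * e) by ring]
      omega
    have hmap : cyclotomicQuotient j z ^ p ^ 2 ^ m = cyclotomicQuotient j (-z) := by
      rw [← hfrob]
      exact map_cyclotomicQuotient (iterateFrobenius F p (2 ^ m)) j z
    rw [hexp, pow_mul, pow_add, pow_one, hmap, cyclotomicQuotient_mul_neg, mul_pow, ← pow_mul,
      ((even_pow_half hp9 m).mul_left j).neg_one_pow, one_mul,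
      ih (by rw [← pow_mul, ← pow_succ', ← hz]), ← pow_mul, ← pow_succ']

lemma natCast_pow_eq_neg_one_iff (a b : ℕ) :
    (a : ZMod p) ^ b = -1 ↔ (a : F) ^ b = -1 := by
  rw [← (ZMod.castHom dvd_rfl F).injective.eq_iff]
  simp

lemma one_add_add_inv_pow_half_eq_one_iff (hp9 : p % 16 = 9) {z : F} (hz : z ^ 4 = -1) :
    (z⁻¹ + 1 + z) ^ (p / 2) = 1 ↔ (2 : ZMod p) ^ ((p - 1) / 4) = -1 := by
  have hne := neg_one_ne_one_of_mod_sixteen (F := F) hp9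
  have hz0 : z ≠ 0 := by rintro rfl; simp at hz
  have hz1 : 1 + z ≠ 0 := by
    intro h
    rw [eq_neg_of_add_eq_zero_right h] at hz
    norm_num at hz
    exact hne hz.symm
  have hza : z ^ (p / 2) = -1 := by
    simpa using pow_half_eq_neg_one hp9 0 (z := z) (by simpa using hz)
  have hpz : z ^ p = z := by
    rw [show p = p / 2 * 2 + 1 by omega, pow_succ, pow_mul, hza]; simp
  have h1 : (1 + z) ^ (p / 2 * 2) = 1 := by
    apply mul_right_cancel₀ hz1
    rw [← pow_succ, show p / 2 * 2 + 1 = p by omega, add_pow_char, hpz]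
    simp
  have hsq : (z + z⁻¹) ^ 2 = 2 := by
    field_simp
    linear_combination hz
  have h2 : (z + z⁻¹) ^ (p / 2) = 2 ^ ((p - 1) / 4) := by
    rw [show p / 2 = 2 * ((p - 1) / 4) by omega, pow_mul, hsq]
  have hmul : (1 + z) ^ 2 = z * (z + z⁻¹) * (z⁻¹ + 1 + z) := by
    field_simp
    linear_combination -hz
  have hprod : -(2 : F) ^ ((p - 1) / 4) * (z⁻¹ + 1 + z) ^ (p / 2) = 1 := by
    rw [mul_comm, pow_mul, hmul, mul_pow, mul_pow, hza, h2, neg_one_mul] at h1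
    exact h1
  have := natCast_pow_eq_neg_one_iff (F := F) (p := p) 2 ((p - 1) / 4)
  rw [Nat.cast_ofNat, Nat.cast_ofNat] at this
  rw [this]
  constructor
  · intro h
    rw [h] at hprod
    linear_combination -hprod
  · intro h
    rw [h] at hprod
    simpa using hprod

lemma cyclotomicQuotient_ne_zero (hp9 : p % 16 = 9) {m : ℕ} {z : F} (hz : z ^ 2 ^ (m + 2) = -1)
    (j : ℕ) : cyclotomicQuotient j z ≠ 0 := by
  have hne := neg_one_ne_one_of_mod_sixteen (F := F) hp9
  have hz0 : z ≠ 0 := by rintro rfl; simp at hz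
  refine mul_ne_zero (pow_ne_zero _ (inv_ne_zero hz0)) (div_ne_zero ?_ ?_)
  · intro h
    apply hne
    have h1 : z ^ (2 * j + 1) = 1 := (sub_eq_zero.1 h).symm
    calc (-1 : F) = (z ^ 2 ^ (m + 2)) ^ (2 * j + 1) := by rw [hz, Odd.neg_one_pow (by simp)]
      _ = 1 := by rw [← pow_mul, mul_comm, pow_mul, h1, one_pow]
  · intro h
    rw [← sub_eq_zero.1 h, one_pow] at hz
    exact hne hz.symm

variable [Finite F]

lemma isSquare_iff_pow_half (hp9 : p % 16 = 9) {m : ℕ} (hF : Nat.card F = p ^ 2 ^ m) {a : F}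
    (ha : a ≠ 0) : IsSquare a ↔ a ^ (p ^ 2 ^ m / 2) = 1 := by
  have := Fintype.ofFinite F
  rw [← hF, Nat.card_eq_fintype_card]
  exact FiniteField.isSquare_iff (by rw [ringChar.eq F p]; rintro rfl; omega) ha

lemma not_isSquare_of_pow_eq_neg_one (hp9 : p % 16 = 9) {m : ℕ} (hF : Nat.card F = p ^ 2 ^ m)
    {z : F} (hz : z ^ 2 ^ (m + 2) = -1) : ¬ IsSquare z := by
  have hz0 : z ≠ 0 := by rintro rfl; simp at hz
  rw [isSquare_iff_pow_half hp9 hF hz0, pow_half_eq_neg_one hp9 m hz]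
  exact neg_one_ne_one_of_mod_sixteen hp9

lemma isSquare_cyclotomicQuotient_iff (hp9 : p % 16 = 9) {m : ℕ} (hF : Nat.card F = p ^ 2 ^ m)
    {z : F} (hz : z ^ 2 ^ (m + 2) = -1) {j : ℕ} (hj : j % 4 = 1 ∨ j % 4 = 2) :
    IsSquare (cyclotomicQuotient j z) ↔ (2 : ZMod p) ^ ((p - 1) / 4) = -1 := by
  have hη : (z ^ 2 ^ m) ^ 4 = -1 := by rw [← hz, ← pow_mul, pow_add]; norm_num
  have hev : Even (p / 2) := ⟨p / 4, by omega⟩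
  rw [isSquare_iff_pow_half hp9 hF (cyclotomicQuotient_ne_zero hp9 hz j),
    cyclotomicQuotient_pow_half hp9 j m hz, ← one_add_add_inv_pow_half_eq_one_iff hp9 hη]
  have hη1 : z ^ 2 ^ m ≠ 1 := by
    intro h
    rw [h, one_pow] at hη
    exact neg_one_ne_one_of_mod_sixteen hp9 hη.symm
  have hη0 : z ^ 2 ^ m ≠ 0 := by intro h; simp [h] at hη
  generalize z ^ 2 ^ m = y at *
  rcases hj with hj | hj <;>
    rw [cyclotomicQuotient_pow_of_modEq hev hj hη, cyclotomicQuotient_eq_geom_sum _ hη1] <;>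
    congr! 2 <;>
    simp only [Finset.sum_range_succ, Finset.sum_range_zero] <;>
    field_simp
  · ring
  · linear_combination hη

lemma isSquare_cyclotomicQuotient (hp9 : p % 16 = 9) {m : ℕ} (hF : Nat.card F = p ^ 2 ^ m)
    {z : F} (hz : z ^ 2 ^ (m + 2) = -1) {j : ℕ} (hj : j % 4 = 0 ∨ j % 4 = 3) :
    IsSquare (cyclotomicQuotient j z) := by
  have hη : (z ^ 2 ^ m) ^ 4 = -1 := by rw [← hz, ← pow_mul, pow_add]; norm_num
  have hev : Even (p / 2) := ⟨p / 4, by omega⟩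
  rw [isSquare_iff_pow_half hp9 hF (cyclotomicQuotient_ne_zero hp9 hz j),
    cyclotomicQuotient_pow_half hp9 j m hz]
  have hη1 : z ^ 2 ^ m ≠ 1 := by
    intro h
    rw [h, one_pow] at hη
    exact neg_one_ne_one_of_mod_sixteen hp9 hη.symm
  have hη0 : z ^ 2 ^ m ≠ 0 := by intro h; simp [h] at hη
  generalize z ^ 2 ^ m = y at *
  rcases hj with hj | hj <;>
    rw [cyclotomicQuotient_pow_of_modEq hev hj hη, cyclotomicQuotient_eq_geom_sum _ hη1] <;>
    refine (congrArg (· ^ (p / 2)) ?_).trans (one_pow _) <;>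
    simp only [Finset.sum_range_succ, Finset.sum_range_zero] <;>
    field_simp
  · ring
  · linear_combination (1 + y + y ^ 2) * hη

end CyclotomicQuotient

/-- A Newton-type square root criterion in complete ultrametric fields. -/
lemma isSquare_of_norm_sq_sub_lt_one {L : Type*} [NormedField L] [IsUltrametricDist L]
    [CompleteSpace L] (h2 : ‖(2 : L)‖ = 1) {b u : L} (hb : ‖b‖ = 1) (h : ‖b ^ 2 - u‖ < 1) :
    ∃ y, y ^ 2 = u := by
  have h20 : (2 : L) ≠ 0 := by rw [← norm_ne_zero_iff, h2]; exact one_ne_zero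
  have hb0 : b ≠ 0 := by rw [← norm_ne_zero_iff, hb]; exact one_ne_zero
  set c := ‖b ^ 2 - u‖ with hc
  let f : L → L := fun y ↦ y - (y ^ 2 - u) / (2 * b)
  let s : Set L := Metric.closedBall b c
  have key : ∀ y ∈ s, ∀ z ∈ s, dist (f y) (f z) ≤ c * dist y z := by
    intro y hy z hz
    rw [Metric.mem_closedBall', dist_eq_norm] at hy hz
    have : f y - f z = (y - z) * (((b - y) + (b - z)) / (2 * b)) := by
      simp only [f]
      field_simp
      ring
    rw [dist_eq_norm, dist_eq_norm, this, norm_mul, norm_div, norm_mul, h2, hb, mul_comm]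
    gcongr
    simpa using (IsUltrametricDist.norm_add_le_max _ _).trans (max_le hy hz)
  have hbs : b ∈ s := Metric.mem_closedBall_self (norm_nonneg _)
  have hfb : dist (f b) b = c := by
    simp [f, h2, hb, hc]
  have hmaps : Set.MapsTo f s s := by
    intro y hy
    refine Metric.mem_closedBall.2 ((IsUltrametricDist.dist_triangle_max _ (f b) _).trans
      (max_le ((key y hy b hbs).trans ?_) hfb.le))
    calc c * dist y b ≤ 1 * c := by
          gcongr
          exact Metric.mem_closedBall.1 hy
      _ = c := one_mul c
  have hlip : LipschitzOnWith ⟨c, norm_nonneg _⟩ f s := LipschitzOnWith.of_dist_le_mul key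
  obtain ⟨y, -, hy, -⟩ := ContractingWith.exists_fixedPoint' Metric.isClosed_closedBall.isComplete
    hmaps ⟨by exact_mod_cast h, hlip.mapsToRestrict hmaps⟩ hbs (edist_ne_top _ _)
  refine ⟨y, ?_⟩
  have : (y ^ 2 - u) / (2 * b) = 0 := by simpa [Function.IsFixedPt, f] using hy
  rw [div_eq_zero_iff, sub_eq_zero] at this
  exact this.resolve_right (mul_ne_zero h20 hb0)

section LocalNorm

open HeightOneSpectrum

variable {K : Type*} [Field K] [NumberField K] {v : HeightOneSpectrum (𝓞 K)}

lemma valued_algebraMap_ringOfIntegers (a : 𝓞 K) :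
    Valued.v (algebraMap K (v.adicCompletion K) (algebraMap (𝓞 K) K a)) = v.intValuation a := by
  rw [← valuation_of_algebraMap (K := K)]
  exact valuedAdicCompletion_eq_valuation' v _

lemma exists_valued_algebraMap_sub_lt_one {x : v.adicCompletion K} (hx : Valued.v x ≤ 1) :
    ∃ a : 𝓞 K, Valued.v (x - algebraMap K (v.adicCompletion K) (algebraMap (𝓞 K) K a)) < 1 := by
  have hopen : IsOpen {y : v.adicCompletion K | Valued.v (x - y) < 1} := by
    have h := (Valued.isOpen_ball (v.adicCompletion K) 1).preimage
      (continuous_const.sub continuous_id : Continuous fun y ↦ x - y)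
    simpa [Set.preimage] using h
  obtain ⟨k, hk⟩ := (denseRange_algebraMap K v).exists_mem_open hopen ⟨x, by simp⟩
  have hk' : Valued.v (x - algebraMap K (v.adicCompletion K) k) < 1 := hk
  have hk1 : v.valuation K k ≤ 1 := by
    rw [← valuedAdicCompletion_eq_valuation']
    change Valued.v (algebraMap K (v.adicCompletion K) k) ≤ 1
    rw [← sub_sub_cancel x (algebraMap K (v.adicCompletion K) k)]
    exact (Valuation.map_sub _ _ _).trans (max_le hx hk'.le)
  obtain ⟨a, ha⟩ := exists_valuation_sub_lt_of_integer v hk1 1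
  refine ⟨a, ?_⟩
  rw [← sub_sub_sub_cancel_right _ _ (algebraMap K (v.adicCompletion K) k), ← map_sub]
  refine (Valuation.map_sub _ _ _).trans_lt (max_lt hk' ?_)
  exact (valuedAdicCompletion_eq_valuation' v _).trans_lt ha

/-- For an odd uniformizer `d` and a unit `a` at `v`, the norm residue symbol `(a, d / v)` is the
quadratic residue symbol of `a` at `v`. -/
lemma isLocalNorm_iff_isSquare_mk (h2 : (2 : 𝓞 K) ∉ v.asIdeal) {d a : 𝓞 K}
    (hd : v.intValuation d = WithZero.exp (-1 : ℤ)) (ha : a ∉ v.asIdeal) :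
    IsLocalNorm K (algebraMap (𝓞 K) K d) (algebraMap (𝓞 K) K a) v ↔
      IsSquare (Ideal.Quotient.mk v.asIdeal a) := by
  let L := v.adicCompletion K
  let i : 𝓞 K →+* L := (algebraMap K L).comp (algebraMap (𝓞 K) K)
  have hi : ∀ r : 𝓞 K, Valued.v (i r) = v.intValuation r := valued_algebraMap_ringOfIntegers
  have hia : Valued.v (i a) = 1 := by rw [hi, intValuation_eq_one_iff.2 ha]
  have hid : Valued.v (i d) = WithZero.exp (-1 : ℤ) := by rw [hi, hd]
  have hmem : ∀ r : 𝓞 K, Valued.v (i r) < 1 ↔ r ∈ v.asIdeal := fun r ↦ by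
    rw [hi, intValuation_lt_one_iff_mem]
  constructor
  · rintro ⟨x, y, hxy⟩
    change i a = x ^ 2 - i d * y ^ 2 at hxy
    have hodd : ∀ w : WithZero (Multiplicative ℤ), w ≠ 0 → Valued.v (i d * y ^ 2) ≠ w ^ 2 := by
      intro w hw h
      have hy0 : Valued.v y ≠ 0 := by
        intro h0
        rw [map_mul, map_pow, h0] at h
        simp [eq_comm, hw] at h
      have := congrArg WithZero.log h
      rw [map_mul, map_pow, hid, WithZero.log_mul (by simp) (by simpa using hy0), WithZero.log_pow,
        WithZero.log_pow, WithZero.log_exp] at this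
      simp only [nsmul_eq_mul, Nat.cast_ofNat] at this
      omega
    have hne : Valued.v (x ^ 2) ≠ Valued.v (i d * y ^ 2) := by
      rcases eq_or_ne (Valued.v x) 0 with h0 | h0
      · intro h
        have hle := Valuation.map_sub Valued.v (x ^ 2) (i d * y ^ 2)
        rw [← hxy, hia, ← h, map_pow, h0] at hle
        simp at hle
      · rw [map_pow]
        exact (hodd _ h0).symm
    have hmax : max (Valued.v (x ^ 2)) (Valued.v (i d * y ^ 2)) = 1 := by
      rw [← hia, hxy, sub_eq_add_neg, Valuation.map_add_of_distinct_val, Valuation.map_neg]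
      rwa [Valuation.map_neg]
    have hx : Valued.v x ≤ 1 := by
      have := (le_max_left _ _).trans_eq hmax
      rwa [map_pow, pow_le_one_iff two_ne_zero] at this
    have hy : Valued.v (i d * y ^ 2) < 1 :=
      lt_of_le_of_ne ((le_max_right _ _).trans_eq hmax) (by simpa using hodd 1 one_ne_zero)
    obtain ⟨b, hb⟩ := exists_valued_algebraMap_sub_lt_one hx
    change Valued.v (x - i b) < 1 at hb
    have hib : Valued.v (i b) ≤ 1 := by rw [hi]; exact intValuation_le_one v b
    refine ⟨Ideal.Quotient.mk _ b, ?_⟩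
    rw [← map_mul, Ideal.Quotient.eq, ← hmem]
    have : i (a - b * b) = (x - i b) * (x + i b) - i d * y ^ 2 := by
      rw [map_sub, hxy, map_mul]; ring
    rw [this]
    refine (Valuation.map_sub _ _ _).trans_lt (max_lt ?_ hy)
    rw [map_mul]
    exact mul_lt_one_of_lt_of_le hb ((Valuation.map_add _ _ _).trans (max_le hx hib))
  · rintro ⟨b', hb⟩
    obtain ⟨b, rfl⟩ := Ideal.Quotient.mk_surjective b'
    rw [← map_mul, Ideal.Quotient.eq] at hb
    have hbv : b ∉ v.asIdeal := fun h ↦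
      ha (by simpa using add_mem hb (Ideal.mul_mem_left _ b h))
    have hnorm : ∀ r : 𝓞 K, r ∉ v.asIdeal → ‖i r‖ = 1 := fun r hr ↦
      (FinitePlace.norm_eq_one_iff_notMem K v r).2 hr
    have h2' : ‖(2 : L)‖ = 1 := by
      rw [← hnorm 2 h2, map_ofNat]
    have hlt : ‖i b ^ 2 - i a‖ < 1 := by
      rw [← map_pow, ← map_sub]
      refine (FinitePlace.norm_lt_one_iff_mem K v _).2 ?_
      rw [pow_two, ← neg_sub]
      exact neg_mem hb
    obtain ⟨y, hy⟩ := isSquare_of_norm_sq_sub_lt_one h2' (hnorm b hbv) hlt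
    exact ⟨y, 0, by rw [hy]; simp [i, L]⟩

end LocalNorm

lemma inv_eq_neg_pow_of_pow_eq_neg_one {F : Type*} [Field F] {x : F} {N : ℕ} (hN : N ≠ 0)
    (hx : x ^ N = -1) : x⁻¹ = -x ^ (N - 1) := by
  refine inv_eq_of_mul_eq_one_right ?_
  rw [mul_neg, mul_pow_sub_one hN, hx, neg_neg]

lemma orderOf_natCast_zmod_two_pow {p : ℕ} (hp9 : p % 16 = 9) (m : ℕ) :
    orderOf (p : ZMod (2 ^ (m + 3))) = 2 ^ m := by
  convert ZMod.orderOf_one_add_mul_prime_pow Nat.prime_two 3 (by simp) (by simp) (p / 8 : ℤ)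
    (by omega) m using 2
  have : (p : ℤ) = 1 + 2 ^ 3 * (p / 8 : ℤ) := by omega
  exact_mod_cast congrArg (Int.cast : ℤ → ZMod (2 ^ (m + 3))) this

section Cyclotomic

variable {K : Type*} [Field K] {v : HeightOneSpectrum (𝓞 K)} {p : ℕ}
  [hp : Fact p.Prime]

lemma liesOver_span_natCast (hv : (p : 𝓞 K) ∈ v.asIdeal) :
    v.asIdeal.LiesOver (Ideal.span {(p : ℤ)}) := by
  have hmax : (Ideal.span {(p : ℤ)}).IsMaximal :=
    Int.ideal_span_isMaximal_of_prime p
  refine ⟨hmax.eq_of_le (Ideal.IsPrime.under ℤ v.asIdeal).ne_top ?_⟩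
  rw [Ideal.span_singleton_le_iff_mem, Ideal.mem_comap]
  simpa using hv

variable [NumberField K]

lemma intValuation_natCast_eq_exp_neg_one {m : ℕ} [NeZero m] [IsCyclotomicExtension {m} ℚ K]
    (hm : ¬ p ∣ m) (hv : (p : 𝓞 K) ∈ v.asIdeal) :
    v.intValuation (p : 𝓞 K) = WithZero.exp (-1 : ℤ) := by
  have := liesOver_span_natCast hv
  have hp0 : (p : 𝓞 K) ≠ 0 := by exact_mod_cast hp.out.ne_zero
  have hpZ : Ideal.span {(p : ℤ)} ≠ ⊥ := by simpa using hp.out.ne_zero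
  have hmap : (Ideal.span {(p : ℤ)}).map (algebraMap ℤ (𝓞 K)) = Ideal.span {(p : 𝓞 K)} := by
    simp [Ideal.map_span]
  have h := IsCyclotomicExtension.Rat.ramificationIdx_eq_of_not_dvd p K v.asIdeal hm
  rw [← Ideal.ramificationIdx'_eq_ramificationIdx (Ideal.span {(p : ℤ)}) v.asIdeal hpZ,
    Ideal.IsDedekindDomain.ramificationIdx'_eq_multiplicity
      (by rwa [hmap, Ne, Ideal.span_singleton_eq_bot]) v.isPrime, hmap] at h
  rw [v.intValuation_eq_exp_neg_multiplicity hp0, h, Nat.cast_one]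

lemma card_quotient_eq_pow_orderOf {m : ℕ} [NeZero m] [IsCyclotomicExtension {m} ℚ K]
    (hm : ¬ p ∣ m) (hv : (p : 𝓞 K) ∈ v.asIdeal) :
    Nat.card (𝓞 K ⧸ v.asIdeal) = p ^ orderOf (p : ZMod m) := by
  have := liesOver_span_natCast hv
  have hmax : (Ideal.span {(p : ℤ)}).IsMaximal :=
    Int.ideal_span_isMaximal_of_prime p
  have := v.isMaximal
  rw [← Submodule.cardQuot_apply, ← Ideal.absNorm_apply,
    Ideal.absNorm_eq_pow_inertiaDeg' v.asIdeal hp.out, Ideal.inertiaDeg'_eq_inertiaDeg,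
    IsCyclotomicExtension.Rat.inertiaDeg_eq_of_not_dvd p K v.asIdeal hm]

end Cyclotomic

/-- For n ≥ 3, p ≡ 9 (mod 16) prime and 𝔭 a prime of K_n = Q(ζ_{2^n}) above p:
(ζ_{2^n}, p / 𝔭) = −1; (ξ_{k,n}, p / 𝔭) = −(2/p)₄ for k ≡ ±3 (mod 8); and
(ξ_{k,n}, p / 𝔭) = 1 for k ≡ ±1 (mod 8), where ξ_{k,n} = ζ^{(1−k)/2}(1−ζ^k)/(1−ζ)
and (2/p)₄ ≡ 2^{(p−1)/4} (mod p). -/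
theorem stmt_14 (n : ℕ) (hn : 3 ≤ n) (p : ℕ) (hp : p.Prime) (hp9 : p % 16 = 9)
    (K : Type*) [Field K] [NumberField K]
    (ζ : K) (hζ : IsPrimitiveRoot ζ (2 ^ n)) (hK : IntermediateField.adjoin ℚ {ζ} = ⊤)
    (v : HeightOneSpectrum (𝓞 K)) (hv : (p : 𝓞 K) ∈ v.asIdeal) :
    ¬ IsLocalNorm K (p : K) ζ v ∧
    ∀ k : ℤ, Odd k → 1 < k → k < 2 ^ (n - 1) →
      ((k % 8 = 3 ∨ k % 8 = 5) →
        (IsLocalNorm K (p : K) (ζ ^ ((1 - k) / 2) * ((1 - ζ ^ k) / (1 - ζ))) v ↔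
          (2 : ZMod p) ^ ((p - 1) / 4) = -1)) ∧
      ((k % 8 = 1 ∨ k % 8 = 7) →
        IsLocalNorm K (p : K) (ζ ^ ((1 - k) / 2) * ((1 - ζ ^ k) / (1 - ζ))) v) := by
  obtain ⟨m, rfl⟩ := Nat.exists_eq_add_of_le' hn
  have : Fact p.Prime := ⟨hp⟩
  have hcyc : IsCyclotomicExtension {2 ^ (m + 3)} ℚ K := by
    have := hζ.intermediateField_adjoin_isCyclotomicExtension ℚ
    rw [hK] at this
    exact IsCyclotomicExtension.equiv _ _ _ IntermediateField.topEquiv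
  have hdvd : ¬ p ∣ 2 ^ (m + 3) := by
    intro h
    have := (Nat.prime_dvd_prime_iff_eq hp Nat.prime_two).1 (hp.dvd_of_dvd_pow h)
    omega
  have hval := intValuation_natCast_eq_exp_neg_one hdvd hv
  have hcard : Nat.card (𝓞 K ⧸ v.asIdeal) = p ^ 2 ^ m := by
    rw [card_quotient_eq_pow_orderOf hdvd hv, orderOf_natCast_zmod_two_pow hp9]
  have := v.isMaximal
  let _ : Field (𝓞 K ⧸ v.asIdeal) := Ideal.Quotient.field v.asIdeal
  have : Finite (𝓞 K ⧸ v.asIdeal) :=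
    Nat.finite_of_card_ne_zero (by rw [hcard]; exact pow_ne_zero _ hp.ne_zero)
  have : CharP (𝓞 K ⧸ v.asIdeal) p := by
    refine (CharP.charP_iff_prime_eq_zero hp).2 ?_
    rw [← map_natCast (Ideal.Quotient.mk v.asIdeal)]
    exact Ideal.Quotient.eq_zero_iff_mem.2 hv
  have h2 : (2 : 𝓞 K) ∉ v.asIdeal := by
    intro h
    rw [← Ideal.Quotient.eq_zero_iff_mem, map_ofNat, ← Nat.cast_ofNat,
      CharP.cast_eq_zero_iff (𝓞 K ⧸ v.asIdeal) p] at h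
    exact hdvd (h.trans (dvd_pow_self 2 (by omega)))
  have hnorm := fun a : 𝓞 K ↦ isLocalNorm_iff_isSquare_mk (a := a) h2 hval
  rw [map_natCast] at hnorm
  set z : 𝓞 K := hζ.toInteger
  have hz' : IsPrimitiveRoot z (2 ^ (m + 3)) := hζ.toInteger_isPrimitiveRoot
  have hzζ : algebraMap (𝓞 K) K z = ζ := rfl
  have hzpow : z ^ 2 ^ (m + 2) = -1 := by
    have : IsPrimitiveRoot (z ^ 2 ^ (m + 2)) 2 := hz'.pow (by positivity) (by ring)
    exact this.eq_neg_one_of_two_right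
  set w := Ideal.Quotient.mk v.asIdeal z with hw
  have hwpow : w ^ 2 ^ (m + 2) = -1 := by rw [hw, ← map_pow, hzpow, map_neg, map_one]
  have hw0 : w ≠ 0 := by rintro h; simp [h] at hwpow
  have hw1 : w ≠ 1 := by
    intro h
    rw [h, one_pow] at hwpow
    exact neg_one_ne_one_of_mod_sixteen hp9 hwpow.symm
  have hζ1 : ζ ≠ 1 := hζ.ne_one (Nat.one_lt_two_pow (by omega))
  have hN : 2 ^ (m + 2) ≠ 0 := by positivity
  constructor
  · rw [← hzζ, hnorm z (by rwa [← Ideal.Quotient.eq_zero_iff_mem])]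
    exact not_isSquare_of_pow_eq_neg_one hp9 hcard hwpow
  · intro k hk hk1 _
    obtain ⟨l, rfl⟩ := hk
    lift l to ℕ using by omega with j
    let ξ : 𝓞 K := (-z ^ (2 ^ (m + 2) - 1)) ^ j * ∑ i ∈ Finset.range (2 * j + 1), z ^ i
    have hξK : ζ ^ ((1 - (2 * (j : ℤ) + 1)) / 2) * ((1 - ζ ^ (2 * (j : ℤ) + 1)) / (1 - ζ)) =
        algebraMap (𝓞 K) K ξ := by
      have : ζ ^ ((1 - (2 * (j : ℤ) + 1)) / 2) * ((1 - ζ ^ (2 * (j : ℤ) + 1)) / (1 - ζ)) =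
          cyclotomicQuotient j ζ := by
        rw [cyclotomicQuotient, show (1 - (2 * (j : ℤ) + 1)) / 2 = -(j : ℤ) by omega, zpow_neg,
          zpow_natCast, inv_pow]
        norm_cast
      rw [this, cyclotomicQuotient_eq_geom_sum j hζ1,
        inv_eq_neg_pow_of_pow_eq_neg_one hN (x := ζ)]
      · simp [ξ, hzζ]
      · rw [← hzζ, ← map_pow, hzpow, map_neg, map_one]
    have hξw : Ideal.Quotient.mk v.asIdeal ξ = cyclotomicQuotient j w := by
      rw [cyclotomicQuotient_eq_geom_sum j hw1, inv_eq_neg_pow_of_pow_eq_neg_one hN hwpow]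
      simp [ξ, hw]
    have hξ0 : ξ ∉ v.asIdeal := by
      rw [← Ideal.Quotient.eq_zero_iff_mem, hξw]
      exact cyclotomicQuotient_ne_zero hp9 hwpow j
    rw [hξK, hnorm ξ hξ0, hξw]
    exact ⟨fun h ↦ isSquare_cyclotomicQuotient_iff hp9 hcard hwpow (by omega),
      fun h ↦ isSquare_cyclotomicQuotient hp9 hcard hwpow (by omega)⟩
end
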